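/- arXiv:2601.09457 — 4 statements merged into one kernel-verified Lean document; each statement's English description precedes it below -/
import Mathlib

section
/- There exists δ₀ > 0 with the following property. Let f : S² → ℝ³ be continuous with sup_{x∈S²} |f(x) − x| ≤ δ₀. For a ∈ ℝ³, R ∈ SO(3), and v ∈ ℝ³ with |v| < 1, define ℰ(a, R, v) := ∫_{S²} |f(R(φ_v(x))) + a − x|² dσ(x). Then ℰ attains a global minimum: there exist a₀ ∈ ℝ³, R₀ ∈ SO(3), and v₀ ∈ ℝ³ with |v₀| < 1 such that ℰ(a₀, R₀, v₀) ≤ ℰ(a, R, v) for all a ∈ ℝ³, R ∈ SO(3), and v with |v| < 1. -/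
open MeasureTheory RealInnerProductSpace Real

noncomputable section

abbrev E3 := EuclideanSpace ℝ (Fin 3)

/-- The standard surface measure `σ` on `S² ⊂ ℝ³`, with `σ(S²) = 4π`. -/
def sphMeasure : Measure (Metric.sphere (0 : E3) 1) := volume.toSphere

/-- The Möbius transformation `φ_v(x) = ((1 − |v|²)x + 2(1 + v·x)v)/(1 + |v|² + 2 v·x)`. -/
def mob (v x : E3) : E3 :=
  (1 + ‖v‖ ^ 2 + 2 * ⟪v, x⟫)⁻¹ • ((1 - ‖v‖ ^ 2) • x + (2 * (1 + ⟪v, x⟫)) • v)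

/-- The action of a `3 × 3` real matrix on `ℝ³`. -/
def matAct (R : Matrix (Fin 3) (Fin 3) ℝ) (x : E3) : E3 := Matrix.toEuclideanLin R x

/-- The normalization functional `ℰ(a, R, v) = ∫_{S²} |f(R(φ_v(x))) + a − x|² dσ(x)`. -/
def En (f : E3 → E3) (a : E3) (R : Matrix (Fin 3) (Fin 3) ℝ) (v : E3) : ℝ :=
  ∫ x : Metric.sphere (0 : E3) 1, ‖f (matAct R (mob v x)) + a - (x : E3)‖ ^ 2 ∂sphMeasure

lemma one_add_norm_sq_add_inner_pos {v x : E3} (hx : ‖x‖ = 1) (hxv : x ≠ -v) :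
    0 < 1 + ‖v‖ ^ 2 + 2 * ⟪v, x⟫ := by
  have h : 0 < ‖v + x‖ := norm_pos_iff.2 fun h => hxv (eq_neg_of_add_eq_zero_right h)
  have := norm_add_sq_real v x
  rw [hx] at this
  nlinarith [pow_pos h 2]

lemma norm_mob {v x : E3} (hx : ‖x‖ = 1) (hxv : x ≠ -v) : ‖mob v x‖ = 1 := by
  have hD := one_add_norm_sq_add_inner_pos hx hxv
  have hN : ‖(1 - ‖v‖ ^ 2) • x + (2 * (1 + ⟪v, x⟫)) • v‖ = 1 + ‖v‖ ^ 2 + 2 * ⟪v, x⟫ := by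
    rw [← sq_eq_sq₀ (norm_nonneg _) hD.le, norm_add_sq_real, norm_smul, norm_smul, hx,
      real_inner_smul_left, real_inner_smul_right, real_inner_comm, mul_pow, mul_pow,
      norm_eq_abs, norm_eq_abs, sq_abs, sq_abs]
    ring
  rw [mob, norm_smul, hN, norm_inv, norm_of_nonneg hD.le, inv_mul_cancel₀ hD.ne']

lemma mob_of_norm_eq_one {v x : E3} (hv : ‖v‖ = 1) (hx : ‖x‖ = 1) (hxv : x ≠ -v) :
    mob v x = v := by
  have hD := one_add_norm_sq_add_inner_pos hx hxv
  rw [mob]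
  simp only [hv] at hD ⊢
  rw [show (1 : ℝ) - 1 ^ 2 = 0 by norm_num, zero_smul, zero_add, smul_smul,
    show (2 : ℝ) * (1 + ⟪v, x⟫) = 1 + 1 ^ 2 + 2 * ⟪v, x⟫ by ring, inv_mul_cancel₀ hD.ne', one_smul]

lemma mob_zero (x : E3) : mob 0 x = x := by simp [mob]

lemma matAct_one (x : E3) : matAct 1 x = x := by simp [matAct]

lemma norm_matAct {R : Matrix (Fin 3) (Fin 3) ℝ}
    (hR : R ∈ Matrix.specialOrthogonalGroup (Fin 3) ℝ) (x : E3) : ‖matAct R x‖ = ‖x‖ := by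
  have h : R.transpose * R = 1 :=
    (Matrix.mem_orthogonalGroup_iff' (Fin 3) ℝ).1 (Matrix.mem_specialOrthogonalGroup_iff.1 hR).1
  rw [← sq_eq_sq₀ (norm_nonneg _) (norm_nonneg _), ← real_inner_self_eq_norm_sq,
    ← real_inner_self_eq_norm_sq, EuclideanSpace.inner_eq_star_dotProduct,
    EuclideanSpace.inner_eq_star_dotProduct]
  simp only [matAct, Matrix.ofLp_toLpLin, Matrix.toLin'_apply, star_trivial]
  rw [Matrix.dotProduct_mulVec, ← Matrix.mulVec_transpose, Matrix.mulVec_mulVec, h,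
    Matrix.one_mulVec]

lemma isCompact_specialOrthogonalGroup :
    IsCompact (Matrix.specialOrthogonalGroup (Fin 3) ℝ : Set (Matrix (Fin 3) (Fin 3) ℝ)) := by
  have hc : IsCompact (Set.univ.pi fun _ : Fin 3 => Set.univ.pi fun _ : Fin 3 =>
      Set.Icc (-1 : ℝ) 1) :=
    isCompact_univ_pi fun _ => isCompact_univ_pi fun _ => isCompact_Icc
  refine IsCompact.of_isClosed_subset (X := Matrix (Fin 3) (Fin 3) ℝ) hc ?_ ?_
  · have : (Matrix.specialOrthogonalGroup (Fin 3) ℝ : Set (Matrix (Fin 3) (Fin 3) ℝ)) =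
        {A | A * A.transpose = 1} ∩ {A | A.det = 1} := by
      ext A
      simp [Matrix.mem_specialOrthogonalGroup_iff, Matrix.mem_orthogonalGroup_iff]
    rw [this]
    exact (isClosed_eq (by fun_prop) (by fun_prop)).inter (isClosed_eq (by fun_prop) (by fun_prop))
  · intro A hA
    exact fun i _ j _ => abs_le.1
      (entry_norm_bound_of_unitary (Matrix.mem_specialOrthogonalGroup_iff.1 hA).1 i j)

instance : IsFiniteMeasure sphMeasure := inferInstanceAs (IsFiniteMeasure (volume.toSphere))

lemma sphMeasure_real_univ_pos : 0 < sphMeasure.real Set.univ := by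
  have : sphMeasure ≠ 0 := Measure.toSphere_ne_zero _
  have : NeZero sphMeasure := ⟨this⟩
  exact measureReal_univ_pos

open scoped Pointwise in
lemma sphMeasure_singleton (p : Metric.sphere (0 : E3) 1) : sphMeasure {p} = 0 := by
  rw [sphMeasure, Measure.toSphere_apply' _ (measurableSet_singleton p), Set.image_singleton]
  have hsub : Set.Ioo (0 : ℝ) 1 • {(p : E3)} ⊆ (Submodule.span ℝ {(p : E3)} : Set E3) := by
    rintro _ ⟨r, -, _, rfl, rfl⟩
    exact Submodule.smul_mem _ _ (Submodule.mem_span_singleton_self _)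
  have hne : Submodule.span ℝ {(p : E3)} ≠ ⊤ := by
    intro h
    have h1 := finrank_span_singleton (K := ℝ) (ne_zero_of_mem_unit_sphere p)
    rw [h, finrank_top, finrank_euclideanSpace_fin] at h1
    norm_num at h1
  rw [measure_mono_null hsub (Measure.addHaar_submodule volume _ hne), mul_zero]

lemma ae_ne_sphMeasure (p : E3) : ∀ᵐ x : Metric.sphere (0 : E3) 1 ∂sphMeasure, (x : E3) ≠ p := by
  by_cases hp : p ∈ Metric.sphere (0 : E3) 1
  · rw [ae_iff]
    have : {x : Metric.sphere (0 : E3) 1 | ¬ (x : E3) ≠ p} = {⟨p, hp⟩} := by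
      ext x
      simp [Subtype.ext_iff]
    rw [this, sphMeasure_singleton]
  · exact Filter.Eventually.of_forall fun x hx => hp (hx ▸ x.2)

open scoped Pointwise in
lemma measurePreserving_neg_sphMeasure :
    MeasurePreserving (fun x : Metric.sphere (0 : E3) 1 => -x) sphMeasure sphMeasure := by
  have hm : Measurable fun x : Metric.sphere (0 : E3) 1 => -x := continuous_neg.measurable
  refine ⟨hm, Measure.ext fun s hs => ?_⟩
  rw [Measure.map_apply hm hs, sphMeasure, Measure.toSphere_apply' _ (hm hs),
    Measure.toSphere_apply' _ hs]
  congr 1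
  have : Set.Ioo (0 : ℝ) 1 • (Subtype.val '' ((fun x => -x) ⁻¹' s) : Set E3) =
      -(Set.Ioo (0 : ℝ) 1 • (Subtype.val '' s : Set E3)) := by
    ext y
    simp only [Set.mem_neg]
    constructor
    · rintro ⟨r, hr, _, ⟨x, hx, rfl⟩, rfl⟩
      exact ⟨r, hr, _, ⟨-x, hx, rfl⟩, by simp⟩
    · rintro ⟨r, hr, _, ⟨x, hx, rfl⟩, h⟩
      refine ⟨r, hr, _, ⟨-x, by simpa using hx, rfl⟩, ?_⟩
      simpa [neg_eq_iff_eq_neg] using congrArg (fun z => -z) h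
  rw [this, Measure.measure_neg]

lemma integral_norm_const_sub_sq_ge (c : E3) :
    sphMeasure.real Set.univ ≤ ∫ x : Metric.sphere (0 : E3) 1, ‖c - (x : E3)‖ ^ 2 ∂sphMeasure := by
  have hint (d : E3) : Integrable (fun x : Metric.sphere (0 : E3) 1 => ‖d - (x : E3)‖ ^ 2)
      sphMeasure :=
    (by fun_prop : Continuous fun x : Metric.sphere (0 : E3) 1 =>
      ‖d - (x : E3)‖ ^ 2).integrable_of_hasCompactSupport (HasCompactSupport.of_compactSpace _)
  have hneg : ∫ x : Metric.sphere (0 : E3) 1, ‖c - (x : E3)‖ ^ 2 ∂sphMeasure =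
      ∫ x : Metric.sphere (0 : E3) 1, ‖c + (x : E3)‖ ^ 2 ∂sphMeasure := by
    rw [← measurePreserving_neg_sphMeasure.integral_comp
      (Homeomorph.neg (Metric.sphere (0 : E3) 1)).measurableEmbedding]
    simp
  have hint' : Integrable (fun x : Metric.sphere (0 : E3) 1 => ‖c + (x : E3)‖ ^ 2) sphMeasure := by
    refine (hint (-c)).congr (Filter.Eventually.of_forall fun x => ?_)
    dsimp only
    rw [← neg_add', norm_neg]
  have hsum : ∫ _ : Metric.sphere (0 : E3) 1, (2 : ℝ) ∂sphMeasure ≤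
      ∫ x : Metric.sphere (0 : E3) 1, (‖c - (x : E3)‖ ^ 2 + ‖c + (x : E3)‖ ^ 2) ∂sphMeasure := by
    refine integral_mono (integrable_const _) ((hint c).add hint') fun x => ?_
    have hx : ‖(x : E3)‖ = 1 := norm_eq_of_mem_sphere x
    have h1 := norm_sub_sq_real c (x : E3)
    have h2 := norm_add_sq_real c (x : E3)
    rw [hx] at h1 h2
    dsimp only
    nlinarith [sq_nonneg ‖c‖]
  rw [integral_add (hint c) hint', ← hneg, integral_const, smul_eq_mul] at hsum
  linarith

/-- The parameters `(R, v, x)` at which the composition of a map of the sphere with a rotation and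
a (possibly degenerate) Möbius transformation is well behaved. -/
def mobDomain : Set (Matrix (Fin 3) (Fin 3) ℝ × E3 × E3) :=
  {q | q.1 ∈ Matrix.specialOrthogonalGroup (Fin 3) ℝ ∧ ‖q.2.2‖ = 1 ∧ q.2.2 ≠ -q.2.1}

lemma matAct_mob_mem_sphere {q : Matrix (Fin 3) (Fin 3) ℝ × E3 × E3} (hq : q ∈ mobDomain) :
    matAct q.1 (mob q.2.1 q.2.2) ∈ Metric.sphere (0 : E3) 1 := by
  rw [mem_sphere_zero_iff_norm, norm_matAct hq.1, norm_mob hq.2.1 hq.2.2]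

lemma continuous_matAct :
    Continuous fun q : Matrix (Fin 3) (Fin 3) ℝ × E3 => matAct q.1 q.2 := by
  simp only [matAct, Matrix.toLpLin_apply]
  fun_prop

lemma continuousOn_comp_matAct_mob {f : E3 → E3}
    (hf : ContinuousOn f (Metric.sphere (0 : E3) 1)) :
    ContinuousOn (fun q : Matrix (Fin 3) (Fin 3) ℝ × E3 × E3 =>
      f (matAct q.1 (mob q.2.1 q.2.2))) mobDomain := by
  have hden : ContinuousOn (fun q : Matrix (Fin 3) (Fin 3) ℝ × E3 × E3 =>
      (1 + ‖q.2.1‖ ^ 2 + 2 * ⟪q.2.1, q.2.2⟫)⁻¹) mobDomain :=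
    ContinuousOn.inv₀ (by fun_prop) fun q hq =>
      (one_add_norm_sq_add_inner_pos hq.2.1 hq.2.2).ne'
  have hnum : ContinuousOn (fun q : Matrix (Fin 3) (Fin 3) ℝ × E3 × E3 =>
      (1 - ‖q.2.1‖ ^ 2) • q.2.2 + (2 * (1 + ⟪q.2.1, q.2.2⟫)) • q.2.1) mobDomain := by
    fun_prop
  have hmob : ContinuousOn (fun q : Matrix (Fin 3) (Fin 3) ℝ × E3 × E3 =>
      (q.1, mob q.2.1 q.2.2)) mobDomain :=
    continuousOn_fst.prodMk (hden.smul hnum)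
  have hact := continuous_matAct.comp_continuousOn hmob
  exact hf.comp hact fun q hq => matAct_mob_mem_sphere hq

lemma aestronglyMeasurable_comp_matAct_mob {f : E3 → E3}
    (hf : ContinuousOn f (Metric.sphere (0 : E3) 1)) {R : Matrix (Fin 3) (Fin 3) ℝ}
    (hR : R ∈ Matrix.specialOrthogonalGroup (Fin 3) ℝ) (v : E3) :
    AEStronglyMeasurable (fun x : Metric.sphere (0 : E3) 1 => f (matAct R (mob v x)))
      sphMeasure := by
  have hs : MeasurableSet {x : Metric.sphere (0 : E3) 1 | (x : E3) ≠ -v} :=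
    (isOpen_ne_fun (by fun_prop) (by fun_prop)).measurableSet
  rw [← Measure.restrict_eq_self_of_ae_mem (ae_ne_sphMeasure (-v))]
  refine ContinuousOn.aestronglyMeasurable ?_ hs
  exact (continuousOn_comp_matAct_mob hf).comp
    (f := fun x : Metric.sphere (0 : E3) 1 => (R, v, (x : E3))) (by fun_prop)
    fun x hx => ⟨hR, norm_eq_of_mem_sphere x, hx⟩

lemma norm_le_of_close {f : E3 → E3}
    (hclose : ∀ x ∈ Metric.sphere (0 : E3) 1, ‖f x - x‖ ≤ 1 / 2) {y : E3}
    (hy : y ∈ Metric.sphere (0 : E3) 1) : ‖f y‖ ≤ 3 / 2 := by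
  have h1 := norm_le_insert' (f y) y
  rw [mem_sphere_zero_iff_norm.1 hy] at h1
  linarith [hclose y hy]

lemma ae_norm_comp_matAct_mob_le {f : E3 → E3}
    (hclose : ∀ x ∈ Metric.sphere (0 : E3) 1, ‖f x - x‖ ≤ 1 / 2) {R : Matrix (Fin 3) (Fin 3) ℝ}
    (hR : R ∈ Matrix.specialOrthogonalGroup (Fin 3) ℝ) (v : E3) :
    ∀ᵐ x : Metric.sphere (0 : E3) 1 ∂sphMeasure, ‖f (matAct R (mob v x))‖ ≤ 3 / 2 := by
  filter_upwards [ae_ne_sphMeasure (-v)] with x hx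
  exact norm_le_of_close hclose
    (matAct_mob_mem_sphere (q := (R, v, (x : E3))) ⟨hR, norm_eq_of_mem_sphere x, hx⟩)

lemma aestronglyMeasurable_En_integrand {f : E3 → E3}
    (hf : ContinuousOn f (Metric.sphere (0 : E3) 1)) {R : Matrix (Fin 3) (Fin 3) ℝ}
    (hR : R ∈ Matrix.specialOrthogonalGroup (Fin 3) ℝ) (a v : E3) :
    AEStronglyMeasurable
      (fun x : Metric.sphere (0 : E3) 1 => ‖f (matAct R (mob v x)) + a - (x : E3)‖ ^ 2)
      sphMeasure :=
  (((aestronglyMeasurable_comp_matAct_mob hf hR v).add_const a).sub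
    continuous_subtype_val.aestronglyMeasurable).norm.pow 2

lemma ae_norm_En_integrand_le {f : E3 → E3}
    (hclose : ∀ x ∈ Metric.sphere (0 : E3) 1, ‖f x - x‖ ≤ 1 / 2) {R : Matrix (Fin 3) (Fin 3) ℝ}
    (hR : R ∈ Matrix.specialOrthogonalGroup (Fin 3) ℝ) {a : E3} {r : ℝ} (ha : ‖a‖ ≤ r) (v : E3) :
    ∀ᵐ x : Metric.sphere (0 : E3) 1 ∂sphMeasure,
      ‖‖f (matAct R (mob v x)) + a - (x : E3)‖ ^ 2‖ ≤ (3 / 2 + r + 1) ^ 2 := by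
  filter_upwards [ae_norm_comp_matAct_mob_le hclose hR v] with x hx
  rw [norm_pow, norm_norm]
  gcongr
  have h1 := norm_sub_le (f (matAct R (mob v x)) + a) (x : E3)
  have h2 := norm_add_le (f (matAct R (mob v x))) a
  rw [norm_eq_of_mem_sphere x] at h1
  linarith

lemma sphMeasure_real_univ_le_En_of_norm_ge {f : E3 → E3}
    (hf : ContinuousOn f (Metric.sphere (0 : E3) 1))
    (hclose : ∀ x ∈ Metric.sphere (0 : E3) 1, ‖f x - x‖ ≤ 1 / 2) {R : Matrix (Fin 3) (Fin 3) ℝ}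
    (hR : R ∈ Matrix.specialOrthogonalGroup (Fin 3) ℝ) {a : E3} (ha : 4 ≤ ‖a‖) (v : E3) :
    sphMeasure.real Set.univ ≤ En f a R v := by
  have hle : ∫ _ : Metric.sphere (0 : E3) 1, (1 : ℝ) ∂sphMeasure ≤ En f a R v := by
    refine integral_mono_ae (integrable_const _)
      (Integrable.of_bound (aestronglyMeasurable_En_integrand hf hR a v) _
        (ae_norm_En_integrand_le hclose hR le_rfl v)) ?_
    filter_upwards [ae_norm_comp_matAct_mob_le hclose hR v] with x hx
    have h1 := norm_sub_norm_le (f (matAct R (mob v x)) + a) (x : E3)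
    have h2 := norm_sub_le (f (matAct R (mob v x)) + a) (f (matAct R (mob v x)))
    rw [norm_eq_of_mem_sphere x] at h1
    rw [add_sub_cancel_left] at h2
    exact one_le_pow₀ (by linarith)
  simpa using hle

lemma sphMeasure_real_univ_le_En_of_norm_eq_one (f : E3 → E3) (a : E3)
    (R : Matrix (Fin 3) (Fin 3) ℝ) {v : E3} (hv : ‖v‖ = 1) :
    sphMeasure.real Set.univ ≤ En f a R v := by
  refine (integral_norm_const_sub_sq_ge (f (matAct R v) + a)).trans_eq (integral_congr_ae ?_)
  filter_upwards [ae_ne_sphMeasure (-v)] with x hx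
  rw [mob_of_norm_eq_one hv (norm_eq_of_mem_sphere x) hx]

lemma En_zero_one_zero_le {f : E3 → E3}
    (hclose : ∀ x ∈ Metric.sphere (0 : E3) 1, ‖f x - x‖ ≤ 1 / 2) :
    En f 0 1 0 ≤ 1 / 4 * sphMeasure.real Set.univ := by
  have hle : En f 0 1 0 ≤ ∫ _ : Metric.sphere (0 : E3) 1, (1 / 4 : ℝ) ∂sphMeasure := by
    refine integral_mono_of_nonneg (Filter.Eventually.of_forall fun x => by positivity)
      (integrable_const _) (Filter.Eventually.of_forall fun x => ?_)
    have := hclose x x.2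
    simp only [mob_zero, matAct_one, add_zero]
    nlinarith [norm_nonneg (f x - x)]
  rw [integral_const, smul_eq_mul, mul_comm] at hle
  exact hle

instance : FirstCountableTopology (Matrix (Fin 3) (Fin 3) ℝ) :=
  inferInstanceAs (FirstCountableTopology (Fin 3 → Fin 3 → ℝ))

/-- The functional extends continuously to the closed ball of degenerate Möbius parameters. -/
lemma continuousOn_En {f : E3 → E3} (hf : ContinuousOn f (Metric.sphere (0 : E3) 1))
    (hclose : ∀ x ∈ Metric.sphere (0 : E3) 1, ‖f x - x‖ ≤ 1 / 2) (r : ℝ) :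
    ContinuousOn (fun p : E3 × Matrix (Fin 3) (Fin 3) ℝ × E3 => En f p.1 p.2.1 p.2.2)
      (Metric.closedBall (0 : E3) r ×ˢ
        (Matrix.specialOrthogonalGroup (Fin 3) ℝ : Set (Matrix (Fin 3) (Fin 3) ℝ)) ×ˢ
        Metric.closedBall (0 : E3) 1) := by
  intro p hp
  refine continuousWithinAt_of_dominated (bound := fun _ => (3 / 2 + r + 1) ^ 2) ?_ ?_
    (integrable_const _) ?_
  · filter_upwards [self_mem_nhdsWithin] with q hq
    exact aestronglyMeasurable_En_integrand hf hq.2.1 _ _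
  · filter_upwards [self_mem_nhdsWithin] with q hq
    exact ae_norm_En_integrand_le hclose hq.2.1 (mem_closedBall_zero_iff.1 hq.1) _
  · filter_upwards [ae_ne_sphMeasure (-p.2.2)] with x hx
    let g : E3 × Matrix (Fin 3) (Fin 3) ℝ × E3 → Matrix (Fin 3) (Fin 3) ℝ × E3 × E3 :=
      fun q => (q.2.1, q.2.2, (x : E3))
    have hg : Continuous g := by fun_prop
    have hne : ∀ᶠ q : E3 × Matrix (Fin 3) (Fin 3) ℝ × E3 in nhds p, (x : E3) ≠ -q.2.2 :=
      (isOpen_ne_fun (by fun_prop) (by fun_prop)).mem_nhds hx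
    have hgp : g p ∈ mobDomain := ⟨hp.2.1, norm_eq_of_mem_sphere x, hx⟩
    have hmap := (continuousOn_comp_matAct_mob hf (g p) hgp).tendsto.comp
      (tendsto_nhdsWithin_iff.2 ⟨hg.continuousWithinAt (s := Metric.closedBall (0 : E3) r ×ˢ
        (Matrix.specialOrthogonalGroup (Fin 3) ℝ : Set (Matrix (Fin 3) (Fin 3) ℝ)) ×ˢ
        Metric.closedBall (0 : E3) 1), by
          filter_upwards [self_mem_nhdsWithin, nhdsWithin_le_nhds hne] with q hq hq'
          exact ⟨hq.2.1, norm_eq_of_mem_sphere x, hq'⟩⟩)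
    have hfst : Filter.Tendsto (fun q : E3 × Matrix (Fin 3) (Fin 3) ℝ × E3 => q.1)
        (nhdsWithin p (Metric.closedBall (0 : E3) r ×ˢ
        (Matrix.specialOrthogonalGroup (Fin 3) ℝ : Set (Matrix (Fin 3) (Fin 3) ℝ)) ×ˢ
        Metric.closedBall (0 : E3) 1)) (nhds p.1) := continuousWithinAt_fst
    exact ((hmap.add hfst).sub_const (x : E3)).norm.pow 2

/-- existence of a global minimizer of the normalization functional `ℰ`
over translations `a ∈ ℝ³`, rotations `R ∈ SO(3)` and Möbius parameters `|v| < 1`,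
provided `f : S² → ℝ³` is continuous and uniformly `δ₀`-close to the identity. -/
theorem stmt0 :
    ∃ δ₀ : ℝ, 0 < δ₀ ∧
      ∀ f : E3 → E3, ContinuousOn f (Metric.sphere (0 : E3) 1) →
        (∀ x ∈ Metric.sphere (0 : E3) 1, ‖f x - x‖ ≤ δ₀) →
        ∃ (a₀ : E3) (R₀ : Matrix (Fin 3) (Fin 3) ℝ) (v₀ : E3),
          R₀ ∈ Matrix.specialOrthogonalGroup (Fin 3) ℝ ∧ ‖v₀‖ < 1 ∧
          ∀ (a : E3) (R : Matrix (Fin 3) (Fin 3) ℝ) (v : E3),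
            R ∈ Matrix.specialOrthogonalGroup (Fin 3) ℝ → ‖v‖ < 1 →
            En f a₀ R₀ v₀ ≤ En f a R v := by
  refine ⟨1 / 2, by norm_num, fun f hf hclose => ?_⟩
  have hcenter := En_zero_one_zero_le hclose
  have hpos := sphMeasure_real_univ_pos
  have hcompact := (isCompact_closedBall (0 : E3) 4).prod
    (isCompact_specialOrthogonalGroup.prod (isCompact_closedBall (0 : E3) 1))
  have hmem : ((0 : E3), (1 : Matrix (Fin 3) (Fin 3) ℝ), (0 : E3)) ∈
      Metric.closedBall (0 : E3) 4 ×ˢ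
        (Matrix.specialOrthogonalGroup (Fin 3) ℝ : Set (Matrix (Fin 3) (Fin 3) ℝ)) ×ˢ
        Metric.closedBall (0 : E3) 1 :=
    ⟨by simp, one_mem (Matrix.specialOrthogonalGroup (Fin 3) ℝ), by simp⟩
  obtain ⟨⟨a₀, R₀, v₀⟩, ⟨-, hR₀, hv₀⟩, hmin⟩ :=
    hcompact.exists_isMinOn ⟨_, hmem⟩ (continuousOn_En hf hclose 4)
  have hmin' (a : E3) (R : Matrix (Fin 3) (Fin 3) ℝ) (v : E3) (ha : ‖a‖ ≤ 4)
      (hR : R ∈ Matrix.specialOrthogonalGroup (Fin 3) ℝ) (hv : ‖v‖ ≤ 1) :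
      En f a₀ R₀ v₀ ≤ En f a R v :=
    isMinOn_iff.1 hmin (a, R, v) ⟨mem_closedBall_zero_iff.2 ha, hR, mem_closedBall_zero_iff.2 hv⟩
  have hlt : En f a₀ R₀ v₀ < sphMeasure.real Set.univ :=
    (hmin' 0 1 0 (by simp) (one_mem _) (by simp)).trans_lt (by linarith)
  refine ⟨a₀, R₀, v₀, hR₀, ?_, fun a R v hR hv => ?_⟩
  · exact lt_of_le_of_ne (mem_closedBall_zero_iff.1 hv₀) fun h =>
      hlt.not_ge (sphMeasure_real_univ_le_En_of_norm_eq_one f a₀ R₀ h)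
  · rcases le_total ‖a‖ 4 with ha | ha
    · exact hmin' a R v ha hR hv.le
    · exact hlt.le.trans (sphMeasure_real_univ_le_En_of_norm_ge hf hclose hR ha v)
end
end

section
/- Let h : ℝ³ → ℝ³ be continuously differentiable, set z(x) := h(x)·x, and define the Dirichlet energy excess E[h] := ∫_{S²} (‖D_T(id + h)(x)‖² − 2) dσ(x), where id denotes the identity map of ℝ³. Then E[h] = 4 ∫_{S²} z dσ + ∫_{S²} ‖D_T h(x)‖² dσ(x). -/
open MeasureTheory RealInnerProductSpace Real

noncomputable section

/-- The orthogonal projection `P_x = Id − x ⊗ x` of `ℝ³` onto the tangent plane `x^⊥`. -/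
def tangProj (x : E3) : E3 →L[ℝ] E3 :=
  ContinuousLinearMap.id ℝ E3 - (innerSL ℝ x).smulRight x

/-- The squared Frobenius (Hilbert–Schmidt) norm of a linear map on `ℝ³`. -/
def frobSq (T : E3 →L[ℝ] E3) : ℝ :=
  ∑ i : Fin 3, ‖T (EuclideanSpace.single i 1)‖ ^ 2

/-- The tangential derivative `D_T g(x) = Dg(x) ∘ P_x`. -/
def tangDeriv (g : E3 → E3) (x : E3) : E3 →L[ℝ] E3 :=
  (fderiv ℝ g x).comp (tangProj x)

open Set Metric in
theorem integral_eq_integral_Ioi_integral_sphere {f : E3 → ℝ} (hf : Integrable f) :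
    ∫ y, f y = ∫ r in Ioi (0 : ℝ), r ^ 2 * ∫ x : sphere (0 : E3) 1, f (r • (x : E3)) ∂sphMeasure := by
  have hmp := (volume : Measure E3).measurePreserving_homeomorphUnitSphereProd
  have hdim : Module.finrank ℝ E3 - 1 = 2 := by simp
  rw [hdim] at hmp
  have hme := (homeomorphUnitSphereProd E3).measurableEmbedding
  set F : sphere (0 : E3) 1 × Ioi (0 : ℝ) → ℝ := fun p => f ((p.2 : ℝ) • (p.1 : E3)) with hF
  have hcomp : F ∘ homeomorphUnitSphereProd E3 = fun y : ({0}ᶜ : Set E3) => f y := by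
    funext y
    have := congrArg Subtype.val ((homeomorphUnitSphereProd E3).symm_apply_apply y)
    rw [homeomorphUnitSphereProd_symm_apply_coe] at this
    exact congrArg f this
  have hint : Integrable F (volume.toSphere.prod (Measure.volumeIoiPow 2)) := by
    rw [← hmp.integrable_comp_emb hme, hcomp]
    exact (integrableOn_iff_comap_subtypeVal (measurableSet_singleton _).compl).1 hf.integrableOn
  calc ∫ y, f y = ∫ y : ({0}ᶜ : Set E3), f y ∂(volume.comap Subtype.val) := by
        rw [integral_subtype_comap (measurableSet_singleton _).compl f, restrict_compl_singleton]
    _ = ∫ p, F p ∂(volume.toSphere.prod (Measure.volumeIoiPow 2)) := by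
        rw [← hmp.integral_comp hme F]
        exact congrArg (fun g : ({0}ᶜ : Set E3) → ℝ => ∫ y, g y ∂(volume.comap Subtype.val)) hcomp.symm
    _ = ∫ r : Ioi (0 : ℝ), ∫ x : sphere (0 : E3) 1, F (x, r) ∂volume.toSphere
          ∂(Measure.volumeIoiPow 2) := integral_prod_symm F hint
    _ = _ := by
      simp only [Measure.volumeIoiPow, ENNReal.ofReal]
      rw [integral_withDensity_eq_integral_smul,
        integral_subtype_comap measurableSet_Ioi fun a : ℝ => Real.toNNReal (a ^ 2) •
          ∫ x : sphere (0 : E3) 1, f (a • (x : E3)) ∂volume.toSphere]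
      · refine setIntegral_congr_fun measurableSet_Ioi fun a _ => ?_
        simp [NNReal.smul_def, Real.coe_toNNReal _ (sq_nonneg a), sphMeasure]
      · exact (measurable_subtype_coe.pow_const _).real_toNNReal

theorem HasCompactSupport.integral_fderiv_eq_zero {E F : Type*} [NormedAddCommGroup E]
    [NormedSpace ℝ E] [FiniteDimensional ℝ E] [MeasurableSpace E] [BorelSpace E]
    [NormedAddCommGroup F] [NormedSpace ℝ F] {μ : Measure E} [μ.IsAddHaarMeasure] {f : E → F}
    (hf : ContDiff ℝ 1 f) (hc : HasCompactSupport f) (v : E) :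
    ∫ y, fderiv ℝ f y v ∂μ = 0 := by
  have hd : Integrable (fun y => fderiv ℝ f y v) μ :=
    ((hf.continuous_fderiv one_ne_zero).clm_apply continuous_const).integrable_of_hasCompactSupport
      (hc.fderiv_apply ℝ v)
  have := integral_smul_fderiv_eq_neg_fderiv_smul_of_integrable (μ := μ) (𝕜 := ℝ)
    (f := fun _ : E => (1 : ℝ)) (g := f) (v := v) (by simp) (by simpa using hd)
    (by simpa using hf.continuous.integrable_of_hasCompactSupport hc)
    (fun _ _ => differentiableAt_const _) (fun x _ => hf.differentiable one_ne_zero x)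
  simpa using this

theorem hasFDerivAt_norm_of_ne_zero {E : Type*} [NormedAddCommGroup E] [InnerProductSpace ℝ E]
    {y : E} (hy : y ≠ 0) : HasFDerivAt (fun z : E => ‖z‖) (‖y‖⁻¹ • innerSL ℝ y) y := by
  have h := (hasStrictFDerivAt_norm_sq y).hasFDerivAt.sqrt (by simpa using hy)
  simp only [Real.sqrt_sq (norm_nonneg _)] at h
  refine h.congr_fderiv ?_
  ext v
  simp
  ring

/-- The trace of a linear map on `ℝ³`. -/
def coordTrace (T : E3 →L[ℝ] E3) : ℝ := ∑ i : Fin 3, T (EuclideanSpace.single i 1) i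

/-- The field `y ↦ u(|y|) h(y/|y|)`. -/
def radialField (u : ℝ → ℝ) (h : E3 → E3) (y : E3) : E3 := u ‖y‖ • h (‖y‖⁻¹ • y)

theorem contDiff_radialField {u : ℝ → ℝ} {h : E3 → E3} (hu : ContDiff ℝ 1 u)
    (hu0 : u =ᶠ[nhds 0] 0) (hh : ContDiff ℝ 1 h) : ContDiff ℝ 1 (radialField u h) := by
  rw [contDiff_iff_contDiffAt]
  intro y
  rcases eq_or_ne y 0 with rfl | hy
  · have : radialField u h =ᶠ[nhds 0] fun _ => 0 := by
      have ht : Filter.Tendsto (fun y : E3 => ‖y‖) (nhds 0) (nhds 0) := by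
        simpa using (continuous_norm (E := E3)).tendsto 0
      filter_upwards [ht.eventually hu0] with y hy
      simp [radialField, hy]
    exact contDiffAt_const.congr_of_eventuallyEq this
  · have hn : ContDiffAt ℝ 1 (fun z : E3 => ‖z‖) y := contDiffAt_norm ℝ hy
    exact (hu.contDiffAt.comp y hn).smul
      (hh.contDiffAt.comp y ((hn.inv (norm_ne_zero_iff.2 hy)).smul contDiffAt_id))

theorem hasCompactSupport_radialField {u : ℝ → ℝ} (hu : HasCompactSupport u) (h : E3 → E3) :
    HasCompactSupport (radialField u h) := by
  obtain ⟨R, hR⟩ := hu.isCompact.isBounded.subset_closedBall 0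
  refine HasCompactSupport.intro (isCompact_closedBall (0 : E3) R) fun y hy => ?_
  have : u ‖y‖ = 0 := image_eq_zero_of_notMem_tsupport fun hm => hy (by simpa using hR hm)
  simp [radialField, this]

theorem coordTrace_fderiv_radialField {u : ℝ → ℝ} {h : E3 → E3} (hu : ContDiff ℝ 1 u)
    (hh : ContDiff ℝ 1 h) {x : E3} (hx : ‖x‖ = 1) {r : ℝ} (hr : 0 < r) :
    coordTrace (fderiv ℝ (radialField u h) (r • x))
      = deriv u r * ⟪h x, x⟫ + u r * r⁻¹ * coordTrace (tangDeriv h x) := by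
  have hnr : ‖r • x‖ = r := by simp [norm_smul, hx, hr.le]
  have hne : r • x ≠ 0 := by rw [← norm_ne_zero_iff, hnr]; exact hr.ne'
  have hx' : r⁻¹ • r • x = x := inv_smul_smul₀ hr.ne' x
  have hn := hasFDerivAt_norm_of_ne_zero hne
  have hproj : HasFDerivAt (fun y : E3 => ‖y‖⁻¹ • y) (r⁻¹ • tangProj x) (r • x) := by
    have := (((hasDerivAt_inv (norm_ne_zero_iff.2 hne)).comp_hasFDerivAt _ hn).smul
      (hasFDerivAt_id (r • x)))
    refine this.congr_fderiv ?_
    ext1 v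
    simp [tangProj, hnr, smul_sub, smul_smul]
    field_simp
    rw [sub_eq_add_neg]
  have hu' : HasDerivAt u (deriv u r) ‖r • x‖ := by
    rw [hnr]; exact (hu.differentiable one_ne_zero r).hasDerivAt
  have hh' : HasFDerivAt h (fderiv ℝ h x) (‖r • x‖⁻¹ • r • x) := by
    rw [hnr, hx']; exact (hh.differentiable one_ne_zero x).hasFDerivAt
  have key : HasFDerivAt (radialField u h) _ (r • x) :=
    (hu'.comp_hasFDerivAt _ hn).smul
      (HasFDerivAt.comp (f := fun y : E3 => ‖y‖⁻¹ • y) (r • x) hh' hproj)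
  rw [key.fderiv]
  simp only [coordTrace, tangDeriv, Fin.sum_univ_three]
  simp [hnr, hx', PiLp.inner_apply, Fin.sum_univ_three]
  field_simp
  ring

theorem Continuous.integrable_sphMeasure {f : Metric.sphere (0 : E3) 1 → ℝ} (hf : Continuous f) :
    Integrable f sphMeasure := by
  have : IsFiniteMeasure sphMeasure := inferInstanceAs (IsFiniteMeasure volume.toSphere)
  exact hf.integrable_of_hasCompactSupport (HasCompactSupport.of_compactSpace f)

theorem continuous_tangDeriv {h : E3 → E3} (hh : ContDiff ℝ 1 h) : Continuous (tangDeriv h) := by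
  have hP : Continuous tangProj := by
    refine continuous_const.sub ?_
    exact ((ContinuousLinearMap.smulRightL ℝ E3 E3).continuous.comp
      (innerSL ℝ).continuous).clm_apply continuous_id
  exact (hh.continuous_fderiv one_ne_zero).clm_comp hP

theorem continuous_coordTrace : Continuous coordTrace := by
  unfold coordTrace
  fun_prop

theorem continuous_frobSq : Continuous frobSq := by
  unfold frobSq
  fun_prop

theorem integral_coordTrace_tangDeriv {h : E3 → E3} (hh : ContDiff ℝ 1 h) :
    ∫ x : Metric.sphere (0 : E3) 1, coordTrace (tangDeriv h (x : E3)) ∂sphMeasure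
      = 2 * ∫ x : Metric.sphere (0 : E3) 1, ⟪h (x : E3), (x : E3)⟫ ∂sphMeasure := by
  let b : ContDiffBump (2 : ℝ) := ⟨1 / 2, 1, by norm_num, by norm_num⟩
  have hb : ContDiff ℝ 1 b := b.contDiff
  have hbs : ∀ r ≤ (1 : ℝ), b r = 0 := fun r hr => b.zero_of_le_dist <| by
    rw [Real.dist_eq, abs_of_nonpos (by linarith)]
    change (1 : ℝ) ≤ _
    linarith
  have hb0 : b =ᶠ[nhds 0] 0 := by
    filter_upwards [Iio_mem_nhds zero_lt_one] with r hr using hbs r hr.le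
  have hbc : HasCompactSupport b := b.hasCompactSupport
  set D := ∫ x : Metric.sphere (0 : E3) 1, coordTrace (tangDeriv h (x : E3)) ∂sphMeasure with hD
  set Z := ∫ x : Metric.sphere (0 : E3) 1, ⟪h (x : E3), (x : E3)⟫ ∂sphMeasure with hZ
  have hG := contDiff_radialField hb hb0 hh
  have hGc := hasCompactSupport_radialField hbc h
  have hint : ∀ i : Fin 3, Integrable
      (fun y => fderiv ℝ (radialField b h) y (EuclideanSpace.single i 1) i) := fun i =>
    (((EuclideanSpace.proj i : E3 →L[ℝ] ℝ).continuous.comp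
      ((hG.continuous_fderiv one_ne_zero).clm_apply
        continuous_const))).integrable_of_hasCompactSupport
      ((hGc.fderiv_apply ℝ _).comp_left (g := (EuclideanSpace.proj i : E3 →L[ℝ] ℝ)) (map_zero _))
  have hdiv : ∫ y, coordTrace (fderiv ℝ (radialField b h) y) = 0 := by
    simp only [coordTrace]
    rw [integral_finsetSum _ fun i _ => hint i]
    refine Finset.sum_eq_zero fun i _ => ?_
    have hi : Integrable (fun y => fderiv ℝ (radialField b h) y (EuclideanSpace.single i 1)) :=
      ((hG.continuous_fderiv one_ne_zero).clm_apply
        continuous_const).integrable_of_hasCompactSupport (hGc.fderiv_apply ℝ _)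
    have := (EuclideanSpace.proj i : E3 →L[ℝ] ℝ).integral_comp_comm hi
    rw [hGc.integral_fderiv_eq_zero hG, map_zero] at this
    exact this
  have hpolar := integral_eq_integral_Ioi_integral_sphere
    (f := fun y => coordTrace (fderiv ℝ (radialField b h) y))
    (by simp only [coordTrace]; exact integrable_finsetSum _ fun i _ => hint i)
  rw [hdiv] at hpolar
  have hdb := hb.continuous_deriv le_rfl
  have hI₁ : Integrable fun r => r ^ 2 * deriv b r + 2 * r * b r :=
    (((continuous_pow 2).mul hdb).add
      ((continuous_const.mul continuous_id).mul hb.continuous)).integrable_of_hasCompactSupport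
      (hbc.deriv.mul_left.add hbc.mul_left)
  have hI₂ : Integrable fun r => r * b r :=
    (continuous_id.mul hb.continuous).integrable_of_hasCompactSupport hbc.mul_left
  have hparts : ∫ r, (r ^ 2 * deriv b r + 2 * r * b r) = 0 := by
    refine integral_eq_zero_of_hasDerivAt_of_integrable (f := fun r => r ^ 2 * b r)
      (fun r => ?_) hI₁
      (((continuous_pow 2).mul hb.continuous).integrable_of_hasCompactSupport hbc.mul_left)
    refine ((hasDerivAt_pow 2 r).mul
      (hb.differentiable one_ne_zero r).hasDerivAt).congr_deriv ?_
    simp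
    ring
  have hpos : 0 < ∫ r, r * b r := by
    refine (continuous_id.mul hb.continuous).integral_pos_of_hasCompactSupport_nonneg_nonzero
      hbc.mul_left (fun r => ?_) (x := 2) ?_
    · rcases le_or_gt r 1 with hr | hr
      · simp [hbs r hr]
      · exact mul_nonneg (by simp; linarith) b.nonneg
    · have : b 2 = 1 := b.one_of_mem_closedBall (by simp [b.rIn_pos.le])
      simp [this]
  have hrad : ∫ r in Set.Ioi (0 : ℝ), r ^ 2 * ∫ x : Metric.sphere (0 : E3) 1,
        coordTrace (fderiv ℝ (radialField b h) (r • (x : E3))) ∂sphMeasure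
      = (D - 2 * Z) * ∫ r, r * b r := by
    have hcD : Continuous fun x : Metric.sphere (0 : E3) 1 => coordTrace (tangDeriv h (x : E3)) :=
      continuous_coordTrace.comp ((continuous_tangDeriv hh).comp continuous_subtype_val)
    have hcZ : Continuous fun x : Metric.sphere (0 : E3) 1 => ⟪h (x : E3), (x : E3)⟫ :=
      (hh.continuous.inner continuous_id).comp continuous_subtype_val
    calc _ = ∫ r in Set.Ioi (0 : ℝ),
          ((r ^ 2 * deriv b r + 2 * r * b r) * Z + r * b r * (D - 2 * Z)) := by
          refine setIntegral_congr_fun measurableSet_Ioi fun r hr => ?_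
          have hr : 0 < r := hr
          have : ∫ x : Metric.sphere (0 : E3) 1,
              coordTrace (fderiv ℝ (radialField b h) (r • (x : E3))) ∂sphMeasure
              = deriv b r * Z + b r * r⁻¹ * D := by
            rw [hZ, hD, ← integral_const_mul, ← integral_const_mul,
              ← integral_add ((hcZ.integrable_sphMeasure).const_mul _)
                ((hcD.integrable_sphMeasure).const_mul _)]
            exact integral_congr_ae <| .of_forall fun x =>
              coordTrace_fderiv_radialField hb hh (norm_eq_of_mem_sphere x) hr
          simp only [this]
          field_simp
          ring
      _ = ∫ r, ((r ^ 2 * deriv b r + 2 * r * b r) * Z + r * b r * (D - 2 * Z)) := by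
          refine setIntegral_eq_integral_of_forall_compl_eq_zero fun r hr => ?_
          have hr : r < 1 := (not_lt.1 hr).trans_lt zero_lt_one
          have hbr : b =ᶠ[nhds r] fun _ => 0 := by
            filter_upwards [Iio_mem_nhds hr] with t ht using hbs t ht.le
          simp [hbs r hr.le, hbr.deriv_eq]
      _ = _ := by
          rw [integral_add (hI₁.mul_const _) (hI₂.mul_const _), integral_mul_const,
            integral_mul_const, hparts]
          ring
  rw [hrad] at hpolar
  have := (mul_eq_zero.1 hpolar.symm).resolve_right hpos.ne'
  linarith

theorem frobSq_tangDeriv_id_add {h : E3 → E3} {x : E3} (hh : DifferentiableAt ℝ h x)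
    (hx : ‖x‖ = 1) :
    frobSq (tangDeriv (fun y => y + h y) x) - 2
      = 2 * coordTrace (tangDeriv h x) + frobSq (tangDeriv h x) := by
  have hadd : tangDeriv (fun y => y + h y) x = tangProj x + tangDeriv h x := by
    have : fderiv ℝ (fun y => y + h y) x = ContinuousLinearMap.id ℝ E3 + fderiv ℝ h x :=
      ((hasFDerivAt_id x).add hh.hasFDerivAt).fderiv
    rw [tangDeriv, this, ContinuousLinearMap.add_comp, ContinuousLinearMap.id_comp, tangDeriv]
  have hker : tangDeriv h x x = 0 := by simp [tangDeriv, tangProj, hx]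
  have hsq : x 0 ^ 2 + x 1 ^ 2 + x 2 ^ 2 = 1 := by
    have := EuclideanSpace.norm_sq_eq x
    rw [hx] at this
    simpa [Fin.sum_univ_three] using this.symm
  rw [hadd]
  generalize tangDeriv h x = T at hker
  have hcoord (j : Fin 3) : x 0 * T (EuclideanSpace.single 0 1) j
      + x 1 * T (EuclideanSpace.single 1 1) j + x 2 * T (EuclideanSpace.single 2 1) j = 0 := by
    have hxsum : x = x 0 • EuclideanSpace.single 0 (1 : ℝ) + x 1 • EuclideanSpace.single 1 (1 : ℝ)
        + x 2 • EuclideanSpace.single 2 (1 : ℝ) := by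
      ext i
      fin_cases i <;> simp
    rw [hxsum, map_add, map_add, map_smul, map_smul, map_smul] at hker
    simpa using congrArg (fun v : E3 => v j) hker
  simp only [frobSq, coordTrace, EuclideanSpace.norm_sq_eq, Fin.sum_univ_three, tangProj]
  simp [EuclideanSpace.inner_single_right]
  linear_combination (x 0 ^ 2 + x 1 ^ 2 + x 2 ^ 2 - 1) * hsq
    - 2 * x 0 * hcoord 0 - 2 * x 1 * hcoord 1 - 2 * x 2 * hcoord 2

/-- the Dirichlet energy excess identity
`E[h] = ∫_{S²}(‖D_T(id + h)‖² − 2) dσ = 4 ∫_{S²} z dσ + ∫_{S²} ‖D_T h‖² dσ`,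
where `z(x) = h(x)·x`. -/
theorem stmt5 (h : E3 → E3) (hh : ContDiff ℝ 1 h) :
    (∫ x : Metric.sphere (0 : E3) 1,
        (frobSq (tangDeriv (fun y : E3 => y + h y) (x : E3)) - 2) ∂sphMeasure)
      = 4 * (∫ x : Metric.sphere (0 : E3) 1, ⟪h (x : E3), (x : E3)⟫ ∂sphMeasure)
        + ∫ x : Metric.sphere (0 : E3) 1, frobSq (tangDeriv h (x : E3)) ∂sphMeasure := by
  have hT : Continuous fun x : Metric.sphere (0 : E3) 1 => tangDeriv h (x : E3) :=
    (continuous_tangDeriv hh).comp continuous_subtype_val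
  have htr : Continuous fun x : Metric.sphere (0 : E3) 1 => coordTrace (tangDeriv h (x : E3)) :=
    continuous_coordTrace.comp hT
  have hfr : Continuous fun x : Metric.sphere (0 : E3) 1 => frobSq (tangDeriv h (x : E3)) :=
    continuous_frobSq.comp hT
  rw [integral_congr_ae (.of_forall fun x : Metric.sphere (0 : E3) 1 =>
      frobSq_tangDeriv_id_add (hh.differentiable one_ne_zero _) (norm_eq_of_mem_sphere x)),
    integral_add (htr.integrable_sphMeasure.const_mul 2) hfr.integrable_sphMeasure,
    integral_const_mul, integral_coordTrace_tangDeriv hh]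
  ring
end
end

section
/- Let z : ℝ³ → ℝ be differentiable at a point x ∈ S² and define g : ℝ³ → ℝ³ by g(y) := z(y)·y. Then the tangential derivative of g at x satisfies the pointwise identity ‖D_T g(x)‖² = |P_x ∇z(x)|² + 2 z(x)². -/
open MeasureTheory RealInnerProductSpace Real

noncomputable section

theorem tangProj_apply (x v : E3) : tangProj x v = v - ⟪x, v⟫ • x := by
  simp [tangProj]

theorem inner_tangProj_right (x v w : E3) : ⟪v, tangProj x w⟫ = ⟪tangProj x v, w⟫ := by
  simp only [tangProj_apply, inner_sub_left, inner_sub_right, real_inner_smul_left,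
    real_inner_smul_right]
  rw [real_inner_comm x v]
  ring

theorem inner_self_tangProj {x : E3} (hx : ‖x‖ = 1) (v : E3) : ⟪tangProj x v, x⟫ = 0 := by
  rw [tangProj_apply, inner_sub_left, real_inner_smul_left, real_inner_self_eq_norm_sq, hx,
    real_inner_comm x v]
  ring

theorem norm_tangProj_sq {x : E3} (hx : ‖x‖ = 1) (v : E3) :
    ‖tangProj x v‖ ^ 2 = ‖v‖ ^ 2 - ⟪x, v⟫ ^ 2 := by
  rw [tangProj_apply, norm_sub_sq_real, real_inner_smul_right, norm_smul, hx,
    real_inner_comm x v, mul_one, Real.norm_eq_abs, sq_abs]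
  ring

theorem sum_inner_single_sq (w : E3) :
    ∑ i : Fin 3, ⟪w, EuclideanSpace.single i (1 : ℝ)⟫ ^ 2 = ‖w‖ ^ 2 := by
  simp [EuclideanSpace.real_norm_sq_eq, EuclideanSpace.inner_single_right]

theorem frobSq_tangProj {x : E3} (hx : ‖x‖ = 1) : frobSq (tangProj x) = 2 := by
  simp only [frobSq, norm_tangProj_sq hx, Finset.sum_sub_distrib, sum_inner_single_sq, hx]
  norm_num

theorem tangDeriv_smul_self_apply {z : E3 → ℝ} {x : E3} (hz : DifferentiableAt ℝ z x) (v : E3) :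
    tangDeriv (fun y : E3 => z y • y) x v
      = z x • tangProj x v + ⟪tangProj x (gradient z x), v⟫ • x := by
  have h : fderiv ℝ z x (tangProj x v) = ⟪gradient z x, tangProj x v⟫ := by
    simp [gradient]
  rw [← inner_tangProj_right, ← h, tangDeriv, fderiv_fun_smul hz differentiableAt_fun_id]
  simp

theorem norm_tangDeriv_smul_self_sq {z : E3 → ℝ} {x : E3} (hx : ‖x‖ = 1)
    (hz : DifferentiableAt ℝ z x) (v : E3) :
    ‖tangDeriv (fun y : E3 => z y • y) x v‖ ^ 2
      = z x ^ 2 * ‖tangProj x v‖ ^ 2 + ⟪tangProj x (gradient z x), v⟫ ^ 2 := by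
  rw [tangDeriv_smul_self_apply hz, norm_add_sq_real, real_inner_smul_left,
    real_inner_smul_right, inner_self_tangProj hx, norm_smul, norm_smul, hx, mul_pow, mul_pow,
    Real.norm_eq_abs, Real.norm_eq_abs, sq_abs, sq_abs]
  ring

/-- the pointwise identity `‖D_T(z·n)(x)‖² = |P_x ∇z(x)|² + 2 z(x)²` on `S²`,
where `n(x) = x` and `g(y) = z(y) y`. -/
theorem stmt6 (z : E3 → ℝ) (x : E3) (hx : x ∈ Metric.sphere (0 : E3) 1)
    (hz : DifferentiableAt ℝ z x) :
    frobSq (tangDeriv (fun y : E3 => z y • y) x)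
      = ‖tangProj x (gradient z x)‖ ^ 2 + 2 * z x ^ 2 := by
  have hx' : ‖x‖ = 1 := by simpa using hx
  have hP := frobSq_tangProj hx'
  simp only [frobSq] at hP
  simp only [frobSq, norm_tangDeriv_smul_self_sq hx' hz, Finset.sum_add_distrib,
    ← Finset.mul_sum, hP, sum_inner_single_sq]
  ring
end
end

section
/- Let A > 0. For every a ∈ ℝ³ with |a| ≤ A, the quantity J(a) := ∫_{S²} (| |x − a| − 1 |)² dσ(x) satisfies J(a) ≥ (16π / (3(A + 2)²)) |a|². -/
open MeasureTheory RealInnerProductSpace Real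

noncomputable section

section SphereIntegrals

variable {E : Type*} [NormedAddCommGroup E] [InnerProductSpace ℝ E] [FiniteDimensional ℝ E]
  [MeasurableSpace E] [BorelSpace E]

open scoped Pointwise in
/-- A linear isometry of `E` preserves the surface measure on the unit sphere. -/
theorem measurePreserving_sphere_linearIsometryEquiv (e : E ≃ₗᵢ[ℝ] E) :
    MeasurePreserving
      (fun x : Metric.sphere (0 : E) 1 => (⟨e x, by simp⟩ : Metric.sphere (0 : E) 1))
      (volume : Measure E).toSphere (volume : Measure E).toSphere := by
  have hm : Measurable
      (fun x : Metric.sphere (0 : E) 1 => (⟨e x, by simp⟩ : Metric.sphere (0 : E) 1)) :=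
    (Continuous.subtype_mk (by fun_prop) _).measurable
  refine ⟨hm, Measure.ext fun s hs => ?_⟩
  rw [Measure.map_apply hm hs, Measure.toSphere_apply' _ (hm hs), Measure.toSphere_apply' _ hs]
  congr 1
  rw [← (e.measurePreserving).measure_preimage_emb e.toMeasurableEquiv.measurableEmbedding
    (Set.Ioo (0 : ℝ) 1 • (Subtype.val '' s))]
  congr 1
  ext y
  simp only [Set.mem_smul, Set.mem_image, Set.mem_preimage, Subtype.exists, exists_and_right,
    exists_eq_right]
  constructor
  · rintro ⟨r, hr, z, ⟨hz, hzs⟩, rfl⟩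
    exact ⟨r, hr, e z, ⟨by simpa using hz, hzs⟩, by simp⟩
  · rintro ⟨r, hr, z, ⟨hz, hzs⟩, h⟩
    refine ⟨r, hr, e.symm z, ⟨by simpa using hz, by simpa using hzs⟩, e.injective ?_⟩
    simpa using h

theorem integral_toSphere_comp_linearIsometryEquiv (e : E ≃ₗᵢ[ℝ] E) {f : E → ℝ}
    (hf : Continuous f) :
    ∫ x : Metric.sphere (0 : E) 1, f (e x) ∂(volume : Measure E).toSphere =
      ∫ x : Metric.sphere (0 : E) 1, f x ∂(volume : Measure E).toSphere := by
  have h := measurePreserving_sphere_linearIsometryEquiv e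
  have key := integral_map (μ := (volume : Measure E).toSphere) h.measurable.aemeasurable
    (f := fun x : Metric.sphere (0 : E) 1 => f x)
    (hf.comp continuous_subtype_val).measurable.aestronglyMeasurable
  rw [h.map_eq] at key
  exact key.symm

theorem integrable_toSphere_of_continuous {f : E → ℝ} (hf : Continuous f) :
    Integrable (fun x : Metric.sphere (0 : E) 1 => f x) (volume : Measure E).toSphere :=
  (hf.comp continuous_subtype_val).integrable_of_hasCompactSupport
    (HasCompactSupport.of_compactSpace _)

theorem integral_toSphere_inner (a : E) :
    ∫ x : Metric.sphere (0 : E) 1, ⟪(x : E), a⟫ ∂(volume : Measure E).toSphere = 0 := by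
  have h := integral_toSphere_comp_linearIsometryEquiv (LinearIsometryEquiv.neg ℝ (E := E))
    (f := fun x => ⟪x, a⟫) (by fun_prop)
  simp only [LinearIsometryEquiv.coe_neg, inner_neg_left, integral_neg] at h
  linarith

theorem integral_toSphere_inner_sq_congr {a b : E} (h : ‖a‖ = ‖b‖) :
    ∫ x : Metric.sphere (0 : E) 1, ⟪(x : E), a⟫ ^ 2 ∂(volume : Measure E).toSphere =
      ∫ x : Metric.sphere (0 : E) 1, ⟪(x : E), b⟫ ^ 2 ∂(volume : Measure E).toSphere := by
  set e := (ℝ ∙ (a - b))ᗮ.reflection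
  have hab : e a = b := Submodule.reflection_sub h
  rw [← integral_toSphere_comp_linearIsometryEquiv e (f := fun x => ⟪x, b⟫ ^ 2) (by fun_prop)]
  simp_rw [← hab, LinearIsometryEquiv.inner_map_map]

theorem finrank_mul_integral_toSphere_inner_sq (a : E) :
    Module.finrank ℝ E *
        ∫ x : Metric.sphere (0 : E) 1, ⟪(x : E), a⟫ ^ 2 ∂(volume : Measure E).toSphere =
      (volume : Measure E).toSphere.real Set.univ * ‖a‖ ^ 2 := by
  set b := stdOrthonormalBasis ℝ E
  have h (i) : ∫ x : Metric.sphere (0 : E) 1, ⟪(x : E), a⟫ ^ 2 ∂(volume : Measure E).toSphere =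
      ∫ x : Metric.sphere (0 : E) 1, ⟪(x : E), ‖a‖ • b i⟫ ^ 2
        ∂(volume : Measure E).toSphere :=
    integral_toSphere_inner_sq_congr (by simp [norm_smul])
  calc _ = ∑ i, ∫ x : Metric.sphere (0 : E) 1, ⟪(x : E), ‖a‖ • b i⟫ ^ 2
        ∂(volume : Measure E).toSphere := by
        simp [← h]
    _ = ∫ x : Metric.sphere (0 : E) 1, ‖a‖ ^ 2 ∂(volume : Measure E).toSphere := by
        rw [← integral_finsetSum _ fun i _ => integrable_toSphere_of_continuous
          (f := fun x => ⟪x, ‖a‖ • b i⟫ ^ 2) (by fun_prop)]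
        refine integral_congr_ae (.of_forall fun x => ?_)
        simp only [inner_smul_right, mul_pow, ← Finset.mul_sum, b.sum_sq_inner_left]
        simp
    _ = _ := by simp

end SphereIntegrals

theorem integral_toSphere_norm_sq_sub_two_mul_inner_sq (a : E3) :
    ∫ x : Metric.sphere (0 : E3) 1, (‖a‖ ^ 2 - 2 * ⟪(x : E3), a⟫) ^ 2
        ∂(volume : Measure E3).toSphere =
      4 * π * ‖a‖ ^ 4 + 16 * π / 3 * ‖a‖ ^ 2 := by
  have hvol : (volume : Measure E3).toSphere.real Set.univ = 4 * π := by
    rw [Measure.toSphere_real_apply_univ, measureReal_def, EuclideanSpace.volume_ball_fin_three]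
    rw [ENNReal.toReal_mul, ENNReal.toReal_ofReal (by positivity)]
    simp
    ring
  have hsq := finrank_mul_integral_toSphere_inner_sq a
  rw [hvol, finrank_euclideanSpace_fin] at hsq
  push_cast at hsq
  have h1 : Integrable (fun x : Metric.sphere (0 : E3) 1 => 4 * ‖a‖ ^ 2 * ⟪(x : E3), a⟫)
      (volume : Measure E3).toSphere :=
    integrable_toSphere_of_continuous (f := fun x => 4 * ‖a‖ ^ 2 * ⟪x, a⟫) (by fun_prop)
  have h2 : Integrable (fun x : Metric.sphere (0 : E3) 1 => 4 * ⟪(x : E3), a⟫ ^ 2)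
      (volume : Measure E3).toSphere :=
    integrable_toSphere_of_continuous (f := fun x => 4 * ⟪x, a⟫ ^ 2) (by fun_prop)
  have h0 : Integrable
      (fun x : Metric.sphere (0 : E3) 1 => ‖a‖ ^ 4 - 4 * ‖a‖ ^ 2 * ⟪(x : E3), a⟫)
      (volume : Measure E3).toSphere :=
    (integrable_const _).sub h1
  have hexp (x : Metric.sphere (0 : E3) 1) : (‖a‖ ^ 2 - 2 * ⟪(x : E3), a⟫) ^ 2 =
      ‖a‖ ^ 4 - 4 * ‖a‖ ^ 2 * ⟪(x : E3), a⟫ + 4 * ⟪(x : E3), a⟫ ^ 2 := by ring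
  simp_rw [hexp]
  rw [integral_add h0 h2, integral_sub (integrable_const _) h1,
    integral_const_mul, integral_const_mul, integral_toSphere_inner, integral_const, hvol,
    smul_eq_mul]
  linarith

theorem norm_sq_sub_two_mul_inner_sq_div_le {E : Type*} [NormedAddCommGroup E]
    [InnerProductSpace ℝ E] {A : ℝ} {x a : E} (hx : ‖x‖ = 1) (ha : ‖a‖ ≤ A) :
    (‖a‖ ^ 2 - 2 * ⟪x, a⟫) ^ 2 / (A + 2) ^ 2 ≤ |‖x - a‖ - 1| ^ 2 := by
  have hA : 0 ≤ A := (norm_nonneg a).trans ha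
  have hle : ‖x - a‖ + 1 ≤ A + 2 := by linarith [norm_sub_le x a]
  have hfac : ‖a‖ ^ 2 - 2 * ⟪x, a⟫ = (‖x - a‖ - 1) * (‖x - a‖ + 1) := by
    have := norm_sub_sq_real x a
    rw [hx] at this
    linarith
  rw [sq_abs, div_le_iff₀ (by positivity), hfac, mul_pow]
  gcongr

/-- the coercivity estimate
`J(a) = ∫_{S²} (| |x − a| − 1 |)² dσ ≥ (16π / (3(A + 2)²)) |a|²` for `|a| ≤ A`. -/
theorem stmt17 (A : ℝ) (hA : 0 < A) (a : E3) (ha : ‖a‖ ≤ A) :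
    (16 * π / (3 * (A + 2) ^ 2)) * ‖a‖ ^ 2 ≤
      ∫ x : Metric.sphere (0 : E3) 1, |‖(x : E3) - a‖ - 1| ^ 2 ∂sphMeasure := by
  unfold sphMeasure
  calc 16 * π / (3 * (A + 2) ^ 2) * ‖a‖ ^ 2
      ≤ (4 * π * ‖a‖ ^ 4 + 16 * π / 3 * ‖a‖ ^ 2) / (A + 2) ^ 2 := by
        have h : 16 * π / (3 * (A + 2) ^ 2) * ‖a‖ ^ 2 =
            (16 * π / 3 * ‖a‖ ^ 2) / (A + 2) ^ 2 := by
          field_simp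
        rw [h]
        gcongr
        exact le_add_of_nonneg_left (by positivity)
    _ = ∫ x : Metric.sphere (0 : E3) 1, (‖a‖ ^ 2 - 2 * ⟪(x : E3), a⟫) ^ 2 / (A + 2) ^ 2
          ∂(volume : Measure E3).toSphere := by
        rw [integral_div, integral_toSphere_norm_sq_sub_two_mul_inner_sq]
    _ ≤ _ := by
        refine integral_mono
          (integrable_toSphere_of_continuous
            (f := fun x => (‖a‖ ^ 2 - 2 * ⟪x, a⟫) ^ 2 / (A + 2) ^ 2) (by fun_prop))
          (integrable_toSphere_of_continuous (f := fun x => |‖x - a‖ - 1| ^ 2) (by fun_prop))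
          fun x => ?_
        exact norm_sq_sub_two_mul_inner_sq_div_le (by simp) ha
end
end
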